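/- There exist constants c > 0 and C > 0 such that for every prime p, every multiplicative subgroup R ⊆ F_p*, and every R-invariant set Q ⊆ F_p* with |Q| ≤ c·p³/|R|³, one has Σ_{ξ ∈ Q} |R ∩ (R − ξ)| ≤ C·|R|·|Q|^{2/3}. -/

import Mathlib

open Finset Pointwise

/-- `R` is (the image in `F_p` of) a multiplicative subgroup of `F_p^*`. -/
def IsMulSubgroup (p : ℕ) (R : Finset (ZMod p)) : Prop :=
  ∃ H : Subgroup (ZMod p)ˣ, (R : Set (ZMod p)) = Units.val '' (H : Set (ZMod p)ˣ)

open Polynomial in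
lemma sparse_zero {p : ℕ} [Fact p.Prime] (m : ℕ) : ∀ f : (ZMod p)[X], f.natDegree < p →
    f.support.card ≤ m → (X + 1) ^ m ∣ f → f = 0 := by
  induction m with
  | zero => intro f _ h _; simpa using h
  | succ m ih =>
    intro f hd hs hdvd
    by_contra hf
    set j := f.natDegree with hj
    set g : (ZMod p)[X] := X * derivative f - C (j : ZMod p) * f with hg
    have hco : ∀ i, g.coeff i = ((i : ZMod p) - j) * f.coeff i := by
      intro i
      rw [hg, coeff_sub, coeff_C_mul]
      cases i with
      | zero => simp
      | succ i => rw [coeff_X_mul, coeff_derivative]; push_cast; ring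
    have hsub : g.support ⊆ f.support.erase j := by
      intro i hi
      rw [mem_support_iff, hco] at hi
      rw [Finset.mem_erase, mem_support_iff]
      refine ⟨?_, right_ne_zero_of_mul hi⟩
      rintro rfl
      simp at hi
    have hjm : j ∈ f.support := natDegree_mem_support_of_nonzero hf
    have hgs : g.support.card ≤ m := by
      have := Finset.card_le_card hsub
      rw [Finset.card_erase_of_mem hjm] at this
      omega
    have hgd : g.natDegree < p := by
      refine lt_of_le_of_lt ?_ hd
      rw [natDegree_le_iff_coeff_eq_zero]
      intro N hN
      rw [hco, coeff_eq_zero_of_natDegree_lt hN, mul_zero]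
    have hgdvd : (X + 1) ^ m ∣ g := by
      obtain ⟨q, hq⟩ := hdvd
      refine dvd_sub (Dvd.dvd.mul_left ?_ _) (Dvd.dvd.mul_left ?_ _)
      · rw [hq, derivative_mul, derivative_pow]
        simp only [Nat.add_sub_cancel]
        refine dvd_add ?_ ?_
        · exact ⟨C ((m + 1 : ℕ) : ZMod p) * derivative (X + 1) * q, by ring⟩
        · exact ⟨(X + 1) * derivative q, by ring⟩
      · exact ⟨(X + 1) * q, by rw [hq]; ring⟩
    have hg0 := ih g hgd hgs hgdvd
    have hfm : f = monomial j (f.coeff j) := by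
      ext i
      rw [coeff_monomial]
      split_ifs with h
      · rw [h]
      · by_cases hij : i ≤ j
        · have h1 := hco i
          rw [hg0, coeff_zero] at h1
          rcases mul_eq_zero.mp h1.symm with h2 | h2
          · exfalso
            rw [sub_eq_zero, ZMod.natCast_eq_natCast_iff', Nat.mod_eq_of_lt (by omega),
              Nat.mod_eq_of_lt hd] at h2
            exact h h2.symm
          · exact h2
        · exact coeff_eq_zero_of_natDegree_lt (by omega)
    have h1 : f.eval (-1) = 0 := by
      obtain ⟨q, hq⟩ := hdvd
      rw [hq]; simp
    rw [hfm, eval_monomial] at h1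
    rcases mul_eq_zero.mp h1 with h2 | h2
    · exact (mem_support_iff.mp hjm) h2
    · exact pow_ne_zero _ (neg_ne_zero.mpr one_ne_zero) h2

open Polynomial in
lemma indep_pow {F : Type*} [Field F] (W : F[X]) (hW : W ≠ 0) (n : ℕ) : ∀ H : Fin n → F[X],
    (∀ c, W ∣ H c → H c = 0) → ∑ c : Fin n, W ^ (c : ℕ) * H c = 0 → ∀ c, H c = 0 := by
  induction n with
  | zero => intro H _ _ c; exact c.elim0
  | succ n ih =>
    intro H h1 h2
    rw [Fin.sum_univ_succ] at h2
    have e : ∑ i : Fin n, W ^ ((Fin.succ i : Fin (n+1)) : ℕ) * H i.succ =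
        W * ∑ i : Fin n, W ^ (i : ℕ) * H i.succ := by
      rw [Finset.mul_sum]
      refine Finset.sum_congr rfl fun i _ => ?_
      rw [Fin.val_succ]; ring
    rw [e] at h2
    simp only [Fin.val_zero, pow_zero, one_mul] at h2
    have h0 : H 0 = 0 := by
      apply h1
      rw [eq_neg_of_add_eq_zero_left h2]
      exact (dvd_mul_right _ _).neg_right
    rw [h0, zero_add] at h2
    have := ih (fun i => H i.succ) (fun c => h1 _) ((mul_eq_zero.mp h2).resolve_left hW)
    intro c
    refine Fin.cases h0 this c

open Polynomial in
/-- numerator polynomials of the derivatives -/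
noncomputable def stepP {F : Type*} [Field F] (a m n : ℕ) : ℕ → F[X]
  | 0 => X ^ a
  | k + 1 => X * (X + 1) * derivative (stepP a m n k) +
      stepP a m n k * ((C (m : F)) * (X + 1) + C (n : F) * X - C (k : F) * (2 * X + 1))

open Polynomial in
lemma stepP_deg {F : Type*} [Field F] (a m n k : ℕ) :
    (stepP (F := F) a m n k).natDegree ≤ a + k := by
  induction k with
  | zero => simp [stepP]
  | succ k ih =>
    rw [stepP]
    refine natDegree_add_le_of_degree_le ?_ ?_
    · by_cases h0 : (stepP (F := F) a m n k).natDegree = 0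
      · rw [natDegree_eq_zero] at h0
        obtain ⟨c, hc⟩ := h0
        rw [← hc]; simp
      · refine natDegree_mul_le.trans ?_
        have h1 := natDegree_derivative_lt h0
        have h2 : (X * (X + 1) : F[X]).natDegree ≤ 2 := by compute_degree
        omega
    · refine natDegree_mul_le.trans ?_
      have h2 : ((C (m : F)) * (X + 1) + C (n : F) * X - C (k : F) * (2 * X + 1) : F[X]).natDegree ≤ 1 := by
        compute_degree
      omega

open Polynomial in
lemma stepP_spec {F : Type*} [Field F] (a m n k : ℕ) :
    (X * (X + 1)) ^ k * derivative^[k] (X ^ a * (X ^ m * (X + 1) ^ n)) =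
      stepP (F := F) a m n k * (X ^ m * (X + 1) ^ n) := by
  induction k with
  | zero => simp [stepP]
  | succ k ih =>
    rw [Function.iterate_succ_apply', stepP]
    set f := derivative^[k] (X ^ a * (X ^ m * (X + 1) ^ n) : F[X])
    set P := stepP (F := F) a m n k
    have h := congrArg (fun q => X * (X + 1) * derivative q) ih
    simp only [derivative_mul, derivative_pow, derivative_X, derivative_add, derivative_one] at h
    have e1 : (X : F[X]) * (C (m : F) * X ^ (m - 1)) = C (m : F) * X ^ m := by
      cases m with
      | zero => simp
      | succ m => simp only [Nat.add_sub_cancel]; ring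
    have e2 : (X + 1 : F[X]) * (C (n : F) * (X + 1) ^ (n - 1)) = C (n : F) * (X + 1) ^ n := by
      cases n with
      | zero => simp
      | succ m => simp only [Nat.add_sub_cancel]; ring
    have e3 : (X * (X + 1) : F[X]) * (C (k : F) * (X * (X + 1)) ^ (k - 1)) =
        C (k : F) * (X * (X + 1)) ^ k := by
      cases k with
      | zero => simp
      | succ m => simp only [Nat.add_sub_cancel]; ring
    linear_combination h - (2 * X + 1) * f * e3 + P * (X + 1) ^ n * (X + 1) * e1 +
      P * X ^ m * X * e2 - (2 * X + 1) * C (k : F) * ih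

open Polynomial in
lemma stepanov_indep {p : ℕ} [Fact p.Prime] (t A B : ℕ) (hA : 0 < A) (hB : 0 < B) (hAB : A * B ≤ t)
    (hdeg : A + t * B ≤ p) (l : Fin A × Fin B × Fin B → ZMod p)
    (h : ∑ i, C (l i) * (X ^ (i.1 : ℕ) * (X ^ (t * (i.2.1 : ℕ)) * (X + 1) ^ (t * (i.2.2 : ℕ)))) =
      (0 : (ZMod p)[X])) : l = 0 := by
  have hAt : A ≤ t := le_trans (Nat.le_mul_of_pos_right A hB) hAB
  have ht : 0 < t := by omega
  set H : Fin B → (ZMod p)[X] := fun c =>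
    ∑ ab : Fin A × Fin B, monomial ((ab.1 : ℕ) + t * (ab.2 : ℕ)) (l (ab.1, ab.2, c)) with hH
  have hinj : ∀ x y : Fin A × Fin B, (x.1 : ℕ) + t * (x.2 : ℕ) = (y.1 : ℕ) + t * (y.2 : ℕ) → x = y := by
    intro x y hxy
    have hx := x.1.2
    have hy := y.1.2
    have h1 := congrArg (· % t) hxy
    simp only [Nat.add_mul_mod_self_left] at h1
    rw [Nat.mod_eq_of_lt (by omega), Nat.mod_eq_of_lt (by omega)] at h1
    rw [h1] at hxy
    have h2 := Nat.eq_of_mul_eq_mul_left ht (Nat.add_left_cancel hxy)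
    exact Prod.ext (Fin.ext h1) (Fin.ext h2)
  have hsupp : ∀ c, (H c).support.card ≤ t := by
    intro c
    have : (H c).support ⊆ Finset.univ.image
        (fun ab : Fin A × Fin B => (ab.1 : ℕ) + t * (ab.2 : ℕ)) := by
      intro i hi
      rw [mem_support_iff, hH, finsetSum_coeff] at hi
      obtain ⟨ab, _, hab⟩ := Finset.exists_ne_zero_of_sum_ne_zero hi
      rw [coeff_monomial] at hab
      rw [Finset.mem_image]
      refine ⟨ab, Finset.mem_univ _, ?_⟩
      by_contra hne
      simp [hne] at hab
    refine (Finset.card_le_card this).trans (Finset.card_image_le.trans ?_)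
    simpa using hAB
  have hd : ∀ c, (H c).natDegree < p := by
    intro c
    refine lt_of_le_of_lt (natDegree_sum_le_of_forall_le (n := p - 1) _ _ ?_) (by omega)
    intro ab _
    refine (natDegree_monomial_le _).trans ?_
    have h1 := ab.1.2
    have h2 : t * (ab.2 : ℕ) ≤ t * B := Nat.mul_le_mul_left _ ab.2.2.le
    omega
  have hW : ((X + 1) ^ t : (ZMod p)[X]) ≠ 0 := by
    have : (X + 1 : (ZMod p)[X]) ≠ 0 := X_add_C_ne_zero 1
    exact pow_ne_zero _ this
  have key := indep_pow ((X + 1) ^ t) hW B H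
    (fun c hc => sparse_zero t (H c) (hd c) (hsupp c) hc) (by
      rw [← h]
      simp only [Fintype.sum_prod_type, hH, Finset.mul_sum]
      rw [Finset.sum_comm]
      refine Finset.sum_congr rfl fun a _ => ?_
      rw [Finset.sum_comm]
      refine Finset.sum_congr rfl fun b _ => Finset.sum_congr rfl fun c _ => ?_
      rw [← C_mul_X_pow_eq_monomial, pow_add, pow_mul (X + 1) t]
      ring)
  funext ⟨a, b, c⟩
  have h1 := congrArg (fun q => q.coeff ((a : ℕ) + t * (b : ℕ))) (key c)
  simp only [hH, finsetSum_coeff, coeff_monomial, coeff_zero] at h1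
  rw [Finset.sum_eq_single (a, b)] at h1
  · simpa using h1
  · intro ab _ hne
    rw [if_neg]
    intro he
    exact hne (hinj ab (a, b) he)
  · simp

open Polynomial in
lemma stepanov_core {p : ℕ} [Fact p.Prime] (t A B D : ℕ) (S U : Finset (ZMod p))
    (hS : ∀ x ∈ S, x ≠ 0 ∧ x + 1 ≠ 0 ∧ (x + 1) ^ t = x ^ t ∧ x ^ t ∈ U)
    (hB : 0 < B) (hAB : A * B ≤ t) (hDA : D ≤ A)
    (hdeg : A + t * B ≤ p) (hU : 2 * U.card * D < B ^ 2) :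
    S.card * D ≤ A + 2 * t * B := by
  rcases Nat.eq_zero_or_pos D with hD | hD
  · simp [hD]
  have hA : 0 < A := by omega
  let L : (Fin A × Fin B × Fin B → ZMod p) →ₗ[ZMod p] (U × Fin D × Fin (2 * A) → ZMod p) :=
    { toFun := fun l v => ∑ i, l i * ((v.1 : ZMod p) ^ ((i.2.1 : ℕ) + (i.2.2 : ℕ)) *
        (stepP (F := ZMod p) i.1 (t * i.2.1) (t * i.2.2) v.2.1).coeff v.2.2)
      map_add' := by
        intro l m; funext v
        simp [add_mul, Finset.sum_add_distrib]
      map_smul' := by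
        intro r l; funext v
        simp [Finset.mul_sum, mul_assoc] }
  have hker : LinearMap.ker L ≠ ⊥ := by
    apply LinearMap.ker_ne_bot_of_finrank_lt
    simp only [Module.finrank_fintype_fun_eq_card, Fintype.card_prod, Fintype.card_fin,
      Fintype.card_coe]
    calc U.card * (D * (2 * A)) = A * (2 * U.card * D) := by ring
      _ < A * (B ^ 2) := Nat.mul_lt_mul_of_pos_left hU hA
      _ = A * (B * B) := by ring
  obtain ⟨l, hl, hl0⟩ := (Submodule.ne_bot_iff _).mp hker
  rw [LinearMap.mem_ker] at hl
  set f : (ZMod p)[X] :=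
    ∑ i, C (l i) * (X ^ (i.1 : ℕ) * (X ^ (t * (i.2.1 : ℕ)) * (X + 1) ^ (t * (i.2.2 : ℕ)))) with hf
  have hf0 : f ≠ 0 := fun h => hl0 (stepanov_indep t A B hA hB hAB hdeg l h)
  have hfd : f.natDegree ≤ A + 2 * t * B := by
    refine natDegree_sum_le_of_forall_le _ _ ?_
    intro i _
    have h1 := i.1.2
    have h2 : t * (i.2.1 : ℕ) ≤ t * B := Nat.mul_le_mul_left _ i.2.1.2.le
    have h3 : t * (i.2.2 : ℕ) ≤ t * B := Nat.mul_le_mul_left _ i.2.2.2.le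
    have h4 : (C (l i) * (X ^ (i.1 : ℕ) * (X ^ (t * (i.2.1 : ℕ)) * (X + 1) ^ (t * (i.2.2 : ℕ)))) :
        (ZMod p)[X]).natDegree ≤ i.1 + (t * i.2.1 + t * i.2.2 * 1) := by
      refine (natDegree_C_mul_le _ _).trans (natDegree_mul_le_of_le (natDegree_X_pow_le _)
        (natDegree_mul_le_of_le (natDegree_X_pow_le _) (natDegree_pow_le_of_le _ ?_)))
      compute_degree
    refine h4.trans ?_
    have : 2 * t * B = t * B + t * B := by ring
    omega
  have hder : ∀ x ∈ S, ∀ k < D, (derivative^[k] f).IsRoot x := by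
    intro x hx k hk
    obtain ⟨hx0, hx1, hxt, hxU⟩ := hS x hx
    -- the combined numerator vanishes
    have hz : ∑ i, C (l i * (x ^ t) ^ ((i.2.1 : ℕ) + (i.2.2 : ℕ))) *
        stepP (F := ZMod p) i.1 (t * i.2.1) (t * i.2.2) k = 0 := by
      ext j
      rw [finsetSum_coeff, coeff_zero]
      by_cases hj : j < 2 * A
      · have := congrFun hl (⟨x ^ t, hxU⟩, ⟨k, hk⟩, ⟨j, hj⟩)
        simp only [L, LinearMap.coe_mk, AddHom.coe_mk, Pi.zero_apply] at this
        rw [← this]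
        refine Finset.sum_congr rfl fun i _ => ?_
        rw [coeff_C_mul, mul_assoc]
      · refine Finset.sum_eq_zero fun i _ => ?_
        have h1 := stepP_deg (F := ZMod p) i.1 (t * i.2.1) (t * i.2.2) k
        have h2 := i.1.2
        rw [coeff_C_mul, coeff_eq_zero_of_natDegree_lt (by omega), mul_zero]
    have h1 : (X * (X + 1)) ^ k * derivative^[k] f =
        ∑ i, C (l i) * (stepP (F := ZMod p) i.1 (t * i.2.1) (t * i.2.2) k *
          (X ^ (t * (i.2.1 : ℕ)) * (X + 1) ^ (t * (i.2.2 : ℕ)))) := by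
      rw [hf, iterate_derivative_sum, Finset.mul_sum]
      refine Finset.sum_congr rfl fun i _ => ?_
      rw [iterate_derivative_C_mul, ← stepP_spec]
      ring
    have h2 := congrArg (eval x) h1
    have h3 := congrArg (eval x) hz
    rw [eval_finsetSum] at h2 h3
    have h4 : eval x ((X * (X + 1)) ^ k * derivative^[k] f) = 0 := by
      rw [h2, ← eval_zero (x := x), ← h3]
      refine Finset.sum_congr rfl fun i _ => ?_
      simp only [eval_mul, eval_C, eval_pow, eval_X, eval_add, eval_one, pow_mul, hxt]
      ring
    rw [eval_mul] at h4
    refine (mul_eq_zero.mp h4).resolve_left ?_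
    simp [hx0, hx1]
  have hmult : ∀ x ∈ S, D ≤ f.rootMultiplicity x := by
    intro x hx
    have : D - 1 < f.rootMultiplicity x := by
      rw [lt_rootMultiplicity_iff_isRoot_iterate_derivative_of_mem_nonZeroDivisors' hf0]
      · intro m hm
        exact hder x hx m (by omega)
      · intro m hm hm0
        rw [mem_nonZeroDivisors_iff_ne_zero, Ne, ZMod.natCast_eq_zero_iff]
        intro hdv
        have := Nat.le_of_dvd (Nat.pos_of_ne_zero hm0) hdv
        omega
    omega
  have hle : D • S.val ≤ f.roots := by
    rw [Multiset.le_iff_count]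
    intro x
    rw [Multiset.count_nsmul, count_roots]
    by_cases hx : x ∈ S
    · rw [Multiset.count_eq_one_of_mem S.nodup hx]
      simpa using hmult x hx
    · rw [Multiset.count_eq_zero_of_notMem hx]; simp
  have := Multiset.card_le_card hle
  rw [Multiset.card_nsmul, Finset.card_val] at this
  have h5 := card_roots' f
  calc S.card * D = D * S.card := mul_comm _ _
    _ ≤ _ := this.trans (h5.trans hfd)

lemma exists_cbrt (q : ℕ) : ∃ B : ℕ, B ^ 3 ≤ q ∧ q < (B + 1) ^ 3 := by
  induction q with
  | zero => exact ⟨0, by simp⟩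
  | succ q ih =>
    obtain ⟨B, h1, h2⟩ := ih
    by_cases h : q + 1 < (B + 1) ^ 3
    · exact ⟨B, by omega, h⟩
    · refine ⟨B + 1, by omega, ?_⟩
      have : (B + 1) ^ 3 < (B + 1 + 1) ^ 3 := Nat.pow_lt_pow_left (by omega) (by norm_num)
      omega

lemma subgroup_facts {p : ℕ} [Fact p.Prime] (R : Finset (ZMod p)) (hR : IsMulSubgroup p R) :
    0 < R.card ∧ ∀ r ∈ R, r ≠ 0 ∧ r ^ R.card = 1 := by
  obtain ⟨H, hH⟩ := hR
  have hcard : Nat.card H = R.card := by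
    rw [← Set.ncard_coe_finset, hH, Set.ncard_image_of_injective _ Units.val_injective]
    rfl
  refine ⟨?_, ?_⟩
  · rw [← hcard]; exact Nat.card_pos
  · intro r hr
    have : r ∈ (R : Set (ZMod p)) := hr
    rw [hH] at this
    obtain ⟨u, hu, rfl⟩ := this
    refine ⟨u.ne_zero, ?_⟩
    have h1 : (⟨u, hu⟩ : H) ^ Nat.card H = 1 := pow_card_eq_one'
    have h2 : u ^ Nat.card H = 1 := congrArg Subtype.val h1
    rw [← hcard, ← Units.val_pow_eq_pow_val, h2, Units.val_one]

/-- The combinatorial part, over the naturals. -/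
lemma stepanov_nat {p : ℕ} [Fact p.Prime] (R Q : Finset (ZMod p)) (hR : IsMulSubgroup p R)
    (h0 : (0 : ZMod p) ∉ Q) (hQR : Q * R = Q) (B : ℕ) (hB : 0 < B)
    (hq : Q.card < (B + 1) ^ 3) (hp : 2 * R.card * B ≤ p) :
    ∑ ξ ∈ Q, (R ∩ R.image (fun r => r - ξ)).card ≤ 96 * R.card * B ^ 2 := by
  obtain ⟨ht, hr⟩ := subgroup_facts R hR
  set t := R.card with htdef
  set T : Finset ((_ : ZMod p) × ZMod p) := Q.sigma (fun ξ => R ∩ R.image (fun r => r - ξ)) with hT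
  have hTc : ∑ ξ ∈ Q, (R ∩ R.image (fun r => r - ξ)).card = T.card := by
    rw [hT, Finset.card_sigma]
  have hmem : ∀ x ∈ T, x.1 ∈ Q ∧ x.2 ∈ R ∧ x.2 + x.1 ∈ R := by
    intro x hx
    rw [hT, Finset.mem_sigma, Finset.mem_inter, Finset.mem_image] at hx
    obtain ⟨h1, h2, r, h3, h4⟩ := hx
    refine ⟨h1, h2, ?_⟩
    rw [← h4]; simpa using h3
  rw [hTc]
  by_cases hcase : 16 * B ≤ t
  · set S : Finset (ZMod p) := T.image (fun x => x.2 / x.1) with hSdef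
    set U : Finset (ZMod p) := Q.image (fun ξ => (ξ⁻¹) ^ t) with hUdef
    have hTS : T.card ≤ t * S.card := by
      rw [htdef, ← Finset.card_product]
      refine Finset.card_le_card_of_injOn (fun x => (x.2, x.2 / x.1)) ?_ ?_
      · intro x hx
        have hx' : x ∈ T := hx
        simp only [Finset.coe_product, Set.mem_prod, Finset.mem_coe]
        exact ⟨(hmem x hx').2.1, Finset.mem_image_of_mem _ hx'⟩
      · rintro ⟨a, b⟩ hx ⟨c, d⟩ hy hxy
        simp only [Prod.mk.injEq] at hxy
        obtain ⟨rfl, h2⟩ := hxy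
        have hb := (hr b (hmem _ hx).2.1).1
        have hac : a = c := by
          rw [div_eq_mul_inv, div_eq_mul_inv] at h2
          exact inv_injective (mul_left_cancel₀ hb h2)
        rw [hac]
    have hUc : U.card * t ≤ Q.card := by
      rw [Finset.card_eq_sum_card_image (fun ξ => (ξ⁻¹) ^ t) Q, ← smul_eq_mul]
      refine Finset.card_nsmul_le_sum _ _ _ ?_
      intro u hu
      rw [Finset.mem_image] at hu
      obtain ⟨ξ, hξ, rfl⟩ := hu
      have hξ0 : ξ ≠ 0 := fun h => h0 (h ▸ hξ)
      refine Finset.card_le_card_of_injOn (fun r => ξ * r) ?_ ?_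
      · intro r hrR
        have hrR' : r ∈ R := hrR
        simp only [Finset.coe_filter, Set.mem_ofPred_eq]
        refine ⟨?_, ?_⟩
        · rw [← hQR]; exact Finset.mul_mem_mul hξ hrR'
        · rw [mul_inv, mul_pow, inv_pow r, (hr r hrR').2]; simp
      · intro a _ b _ hab
        exact mul_left_cancel₀ hξ0 hab
    have hS : ∀ x ∈ S, x ≠ 0 ∧ x + 1 ≠ 0 ∧ (x + 1) ^ t = x ^ t ∧ x ^ t ∈ U := by
      intro x hx
      rw [hSdef, Finset.mem_image] at hx
      obtain ⟨y, hy, rfl⟩ := hx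
      obtain ⟨h1, h2, h3⟩ := hmem y hy
      have hy0 : y.1 ≠ 0 := fun h => h0 (h ▸ h1)
      have e1 : y.2 / y.1 + 1 = (y.2 + y.1) / y.1 := by field_simp
      have e2 : (y.2 / y.1) ^ t = (y.1⁻¹) ^ t := by
        rw [div_pow, (hr _ h2).2, inv_pow, one_div]
      refine ⟨div_ne_zero (hr _ h2).1 hy0, ?_, ?_, ?_⟩
      · rw [e1]; exact div_ne_zero (hr _ h3).1 hy0
      · rw [e1, e2, div_pow, (hr _ h3).2, inv_pow, one_div]
      · rw [e2]; exact Finset.mem_image_of_mem (fun ξ => (ξ⁻¹) ^ t) h1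
    set A := t / B with hA
    set D := t / (16 * B) with hD
    have hAB : A * B ≤ t := Nat.div_mul_le_self _ _
    have hDB : D * (16 * B) ≤ t := Nat.div_mul_le_self _ _
    have hDA : D ≤ A := Nat.div_le_div_left (by omega) hB
    have hD1 : 1 ≤ D := (Nat.one_le_div_iff (by omega)).mpr hcase
    have hDt : t < 16 * B * (D + 1) := Nat.lt_mul_div_succ t (by omega)
    have hAt : A ≤ t * B := (Nat.div_le_self _ _).trans (Nat.le_mul_of_pos_right _ hB)
    have hU : 2 * U.card * D < B ^ 2 := by
      have h1 : 2 * U.card * D * (16 * B) ≤ 2 * Q.card := by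
        calc 2 * U.card * D * (16 * B) = 2 * (U.card * (D * (16 * B))) := by ring
          _ ≤ 2 * (U.card * t) := by gcongr
          _ ≤ 2 * Q.card := by gcongr
      have h2 : (B + 1) ^ 3 ≤ (2 * B) ^ 3 := Nat.pow_le_pow_left (by omega) 3
      have h3 : 2 * U.card * D * (16 * B) < B ^ 2 * (16 * B) := by
        calc _ ≤ 2 * Q.card := h1
          _ < 2 * (2 * B) ^ 3 := by omega
          _ = _ := by ring
      exact lt_of_mul_lt_mul_right h3 (Nat.zero_le _)
    have hcore := stepanov_core t A B D S U hS hB hAB hDA (by nlinarith) hU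
    have h1 : t ≤ 32 * B * D := by nlinarith
    have h2 : t * S.card ≤ t * (96 * B ^ 2) := by
      calc t * S.card ≤ 32 * B * D * S.card := by gcongr
        _ = 32 * B * (S.card * D) := by ring
        _ ≤ 32 * B * (t * B + 2 * t * B) := by
          refine Nat.mul_le_mul_left _ (hcore.trans ?_)
          omega
        _ = t * (96 * B ^ 2) := by ring
    calc T.card ≤ t * S.card := hTS
      _ ≤ _ := h2
      _ = _ := by ring
  · have h1 : T.card ≤ t * t := by
      rw [htdef, ← Finset.card_product]
      refine Finset.card_le_card_of_injOn (fun x => (x.2, x.2 + x.1)) ?_ ?_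
      · intro x hx
        have hx' : x ∈ T := hx
        simp only [Finset.coe_product, Set.mem_prod, Finset.mem_coe]
        exact (hmem x hx').2
      · rintro ⟨a, b⟩ hx ⟨c, d⟩ hy hxy
        simp only [Prod.mk.injEq] at hxy
        obtain ⟨rfl, h2⟩ := hxy
        rw [add_left_cancel h2]
    refine h1.trans ?_
    have h3 : t ≤ 96 * B ^ 2 := by nlinarith
    calc t * t ≤ t * (96 * B ^ 2) := by gcongr
      _ = _ := by ring

theorem stepanov_convolution_bound :
    ∃ c C : ℝ, 0 < c ∧ 0 < C ∧
      ∀ p : ℕ, p.Prime →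
        ∀ R Q : Finset (ZMod p), IsMulSubgroup p R →
          (0 : ZMod p) ∉ Q → Q * R = Q →
          (Q.card : ℝ) ≤ c * (p : ℝ) ^ 3 / (R.card : ℝ) ^ 3 →
          ∑ ξ ∈ Q, ((R ∩ R.image (fun r => r - ξ)).card : ℝ) ≤
            C * (R.card : ℝ) * (Q.card : ℝ) ^ ((2 : ℝ) / 3) := by
  refine ⟨1 / 8, 96, by norm_num, by norm_num, ?_⟩
  intro p hp R Q hR h0 hQR hc
  have : Fact p.Prime := ⟨hp⟩
  rcases Q.eq_empty_or_nonempty with rfl | hne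
  · simp
  have hq : 0 < Q.card := hne.card_pos
  obtain ⟨B, hB1, hB2⟩ := exists_cbrt Q.card
  have hB : 0 < B := by
    rcases Nat.eq_zero_or_pos B with h | h
    · subst h; omega
    · exact h
  have ht := (subgroup_facts R hR).1
  have htR : (0 : ℝ) < (R.card : ℝ) ^ 3 := by positivity
  rw [le_div_iff₀ htR] at hc
  have hB1' : (B : ℝ) ^ 3 ≤ Q.card := by exact_mod_cast hB1
  have hp3 : 2 * R.card * B ≤ p := by
    have : (2 * (R.card : ℝ) * B) ^ 3 ≤ (p : ℝ) ^ 3 := by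
      have := mul_le_mul_of_nonneg_right hB1' htR.le
      calc (2 * (R.card : ℝ) * B) ^ 3 = 8 * ((B : ℝ) ^ 3 * (R.card : ℝ) ^ 3) := by ring
        _ ≤ _ := by linarith
    have h := le_of_pow_le_pow_left₀ (by norm_num) (Nat.cast_nonneg p) this
    exact_mod_cast h
  have hmain := stepanov_nat R Q hR h0 hQR B hB hB2 hp3
  have hB2' : (B : ℝ) ^ 2 ≤ (Q.card : ℝ) ^ ((2 : ℝ) / 3) := by
    calc (B : ℝ) ^ 2 = ((B : ℝ) ^ 3) ^ ((2 : ℝ) / 3) := by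
          rw [← Real.rpow_natCast, ← Real.rpow_natCast, ← Real.rpow_mul (Nat.cast_nonneg B)]
          norm_num
      _ ≤ _ := Real.rpow_le_rpow (by positivity) hB1' (by norm_num)
  have hmain' : ∑ ξ ∈ Q, ((R ∩ R.image (fun r => r - ξ)).card : ℝ) ≤
      96 * (R.card : ℝ) * (B : ℝ) ^ 2 := by exact_mod_cast hmain
  refine hmain'.trans ?_
  gcongr
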